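/- Let E ⊆ F be countable Borel equivalence relations on a standard Borel (Polish) space X such that every F-class is the union of finitely many E-classes and F is not Borel reducible to E. Then E is strictly less complex than E^fin: E is Borel reducible to E^fin but E^fin is not Borel reducible to E. -/

import Mathlib

open TopologicalSpace

/-- The Borel σ-algebra on the hyperspace `K(X)` of nonempty compact subsets of a metric
space `X`, with the topology induced by the Hausdorff metric. -/
noncomputable instance (X : Type) [MetricSpace X] :
    MeasurableSpace (NonemptyCompacts X) := borel _

instance (X : Type) [MetricSpace X] : BorelSpace (NonemptyCompacts X) := ⟨rfl⟩

/-- `Fin(X)`: the nonempty finite subsets of `X`, as a subspace of `K(X)`. -/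
abbrev FinSubsets (X : Type) [MetricSpace X] : Type :=
  {K : NonemptyCompacts X // (K : Set X).Finite}

/-- The relation `E^fin` on `Fin(X)`: `u E^fin v` iff `u` and `v` meet exactly the same
`E`-classes. -/
def EFin {X : Type} [MetricSpace X] (E : X → X → Prop) (u v : FinSubsets X) : Prop :=
  (∀ x ∈ (u.1 : Set X), ∃ y ∈ (v.1 : Set X), E x y) ∧
  (∀ y ∈ (v.1 : Set X), ∃ x ∈ (u.1 : Set X), E x y)

section LusinNovikov

open Set Filter Topology MeasureTheory

variable {Z X Y : Type*}

/-- On each fiber of `f` meeting `G`, the function `g` is constant on `G`. -/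
def FiberConstOn (f : Z → X) (g : Z → Y) (G : Set Z) : Prop :=
  ∀ z ∈ G, ∀ z' ∈ G, f z = f z' → g z = g z'

/-- A countable family of Borel sets on each of which `g` is a function of `f`. -/
def IsUniformFamily [MeasurableSpace Z] (f : Z → X) (g : Z → Y) (𝒢 : Set (Set Z)) : Prop :=
  𝒢.Countable ∧ ∀ G ∈ 𝒢, MeasurableSet G ∧ FiberConstOn f g G

/-- A set of tuples is negligible up to `n` if some uniform family meets each of its tuples
in one of the first `n + 1` coordinates. -/
def NegligibleTuples [MeasurableSpace Z] (f : Z → X) (g : Z → Y) (n : ℕ)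
    (R : Set (ℕ → Z)) : Prop :=
  ∃ 𝒢, IsUniformFamily f g 𝒢 ∧ ∀ p ∈ R, ∃ j ≤ n, p j ∈ ⋃₀ 𝒢

/-- The tuples whose first `n + 1` coordinates lie in the prescribed sets and in one fiber
of `f`. -/
def fiberTuples (f : Z → X) (n : ℕ) (c : ℕ → Set Z) : Set (ℕ → Z) :=
  {p | ∀ j ≤ n, p j ∈ c j ∧ f (p j) = f (p 0)}

theorem IsUniformFamily.iUnion [MeasurableSpace Z] {f : Z → X} {g : Z → Y} {ι : Type*}
    [Countable ι] {𝒢 : ι → Set (Set Z)} (h : ∀ i, IsUniformFamily f g (𝒢 i)) :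
    IsUniformFamily f g (⋃ i, 𝒢 i) := by
  refine ⟨countable_iUnion fun i => (h i).1, fun G hG => ?_⟩
  obtain ⟨i, hi⟩ := mem_iUnion.1 hG
  exact (h i).2 G hi

theorem IsUniformFamily.insert [MeasurableSpace Z] {f : Z → X} {g : Z → Y}
    {𝒢 : Set (Set Z)} (h : IsUniformFamily f g 𝒢) {G : Set Z} (hG : MeasurableSet G)
    (hG' : FiberConstOn f g G) : IsUniformFamily f g (insert G 𝒢) := by
  refine ⟨h.1.insert G, fun H hH => ?_⟩
  rcases hH with rfl | hH
  · exact ⟨hG, hG'⟩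
  · exact h.2 H hH

theorem IsUniformFamily.measurableSet_sUnion [MeasurableSpace Z] {f : Z → X} {g : Z → Y}
    {𝒢 : Set (Set Z)} (h : IsUniformFamily f g 𝒢) : MeasurableSet (⋃₀ 𝒢) :=
  MeasurableSet.sUnion h.1 fun G hG => (h.2 G hG).1

theorem NegligibleTuples.of_subset_iUnion [MeasurableSpace Z] {f : Z → X} {g : Z → Y} {n : ℕ}
    {ι : Type*} [Countable ι] {R : Set (ℕ → Z)} {S : ι → Set (ℕ → Z)}
    (hS : ∀ i, NegligibleTuples f g n (S i)) (hR : R ⊆ ⋃ i, S i) :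
    NegligibleTuples f g n R := by
  choose 𝒢 h𝒢 hcov using hS
  refine ⟨⋃ i, 𝒢 i, IsUniformFamily.iUnion h𝒢, fun p hp => ?_⟩
  obtain ⟨i, hi⟩ := mem_iUnion.1 (hR hp)
  obtain ⟨j, hj, hpj⟩ := hcov i p hi
  exact ⟨j, hj, sUnion_subset_sUnion (subset_iUnion 𝒢 i) hpj⟩

/-- An analytic set on which `g` is a function of `f` is contained in a Borel one. -/
theorem exists_measurableSet_fiberConstOn
    [TopologicalSpace Z] [MeasurableSpace Z] [BorelSpace Z] [PolishSpace Z]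
    [TopologicalSpace X] [T2Space X] [MeasurableSpace X] [BorelSpace X]
    [TopologicalSpace Y] [T0Space Y] [SecondCountableTopology Y]
    [MeasurableSpace Y] [BorelSpace Y]
    {f : Z → X} {g : Z → Y} (hf : Continuous f) (hg : Continuous g)
    {A : Set Z} (hA : AnalyticSet A) (hfg : FiberConstOn f g A) :
    ∃ G, A ⊆ G ∧ MeasurableSet G ∧ FiberConstOn f g G := by
  have sep : ∀ V : TopologicalSpace.countableBasis Y, MeasurablySeparable
      (f '' (A ∩ g ⁻¹' V)) (f '' (A ∩ g ⁻¹' (V : Set Y)ᶜ)) := by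
    intro V
    have hV : MeasurableSet (V : Set Y) :=
      (TopologicalSpace.isOpen_of_mem_countableBasis V.2).measurableSet
    have analytic_inter {S : Set Z} (hS : MeasurableSet S) : AnalyticSet (A ∩ S) := by
      rw [inter_eq_iInter]
      exact AnalyticSet.iInter fun b => by cases b <;> simp [hA, hS.analyticSet]
    refine AnalyticSet.measurablySeparable
      ((analytic_inter (hg.measurable hV)).image_of_continuous hf)
      ((analytic_inter (hg.measurable hV.compl)).image_of_continuous hf) ?_
    rw [Set.disjoint_left]
    rintro _ ⟨z, ⟨hz, hzV⟩, rfl⟩ ⟨z', ⟨hz', hzV'⟩, h⟩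
    exact hzV' (by simpa [hfg z' hz' z hz h] using hzV)
  choose D hD hD' hDm using sep
  have : Countable (TopologicalSpace.countableBasis Y) :=
    (TopologicalSpace.countable_countableBasis Y).to_subtype
  refine ⟨{z | ∀ V : TopologicalSpace.countableBasis Y, g z ∈ (V : Set Y) ↔ f z ∈ D V},
    fun z hz V => ⟨fun h => ?_, fun h => ?_⟩, ?_, fun z hz z' hz' h => ?_⟩
  · exact hD V ⟨z, ⟨hz, h⟩, rfl⟩
  · by_contra hn
    exact Set.disjoint_left.1 (hD' V) ⟨z, ⟨hz, hn⟩, rfl⟩ h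
  · refine measurableSet_setOfPred.2 (Measurable.forall fun V => Measurable.iff ?_ ?_)
    · exact measurableSet_setOfPred.1 (hg.measurable
        (TopologicalSpace.isOpen_of_mem_countableBasis V.2).measurableSet)
    · exact measurableSet_setOfPred.1 (hf.measurable (hDm V))
  · refine (TopologicalSpace.isBasis_countableBasis Y).eq_iff.2 fun V hV => ?_
    rw [hz ⟨V, hV⟩, hz' ⟨V, hV⟩, h]

theorem measurableSet_fiberTuples
    [TopologicalSpace Z] [MeasurableSpace Z] [BorelSpace Z]
    [TopologicalSpace X] [T2Space X] [SecondCountableTopology X] [MeasurableSpace X] [BorelSpace X]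
    {f : Z → X} (hf : Continuous f) {n : ℕ} {c : ℕ → Set Z}
    (hc : ∀ j, MeasurableSet (c j)) : MeasurableSet (fiberTuples f n c) := by
  have : fiberTuples f n c =
      ⋂ j ∈ Iic n, ((fun p : ℕ → Z => p j) ⁻¹' c j ∩ {p | f (p j) = f (p 0)}) := by
    ext p; simp [fiberTuples]
  rw [this]
  refine MeasurableSet.biInter (to_countable _) fun j _ =>
    (measurable_pi_apply j (hc j)).inter ?_
  exact measurableSet_eq_fun (hf.measurable.comp (measurable_pi_apply j))
    (hf.measurable.comp (measurable_pi_apply 0))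

section Splitting

variable [TopologicalSpace Z] [MeasurableSpace Z] [BorelSpace Z] [PolishSpace Z]
  [TopologicalSpace X] [T2Space X] [SecondCountableTopology X] [MeasurableSpace X] [BorelSpace X]
  [TopologicalSpace Y] [T2Space Y] [SecondCountableTopology Y] [MeasurableSpace Y] [BorelSpace Y]
  {f : Z → X} {g : Z → Y}

/-- If a non-negligible family of tuples is doubled at coordinate `i`, requiring distinct values
of `g`, the result is again non-negligible. -/
theorem not_negligibleTuples_split (hf : Continuous f) (hg : Continuous g) {n : ℕ}
    {c : ℕ → Set Z} (hc : ∀ j, MeasurableSet (c j))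
    (h : ¬ NegligibleTuples f g n (fiberTuples f n c)) {i : ℕ} (hi : i ≤ n) :
    ¬ NegligibleTuples f g (n + 1) {p | p ∈ fiberTuples f n c ∧ p (n + 1) ∈ c i ∧
      f (p (n + 1)) = f (p 0) ∧ g (p i) ≠ g (p (n + 1))} := by
  rintro ⟨𝒢, h𝒢, hcov⟩
  apply h
  set R : Set (ℕ → Z) := fiberTuples f n c ∩ {p | ∀ j ≤ n, p j ∉ ⋃₀ 𝒢} with hR
  have hRm : MeasurableSet R := by
    refine (measurableSet_fiberTuples hf hc).inter ?_
    have : {p : ℕ → Z | ∀ j ≤ n, p j ∉ ⋃₀ 𝒢} =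
        ⋂ j ∈ Iic n, (fun p : ℕ → Z => p j) ⁻¹' (⋃₀ 𝒢)ᶜ := by
      ext p; simp
    rw [this]
    exact MeasurableSet.biInter (to_countable _) fun j _ =>
      measurable_pi_apply j h𝒢.measurableSet_sUnion.compl
  have hA : AnalyticSet ((fun p : ℕ → Z => p i) '' R) :=
    hRm.analyticSet.image_of_continuous (continuous_apply i)
  obtain ⟨G, hAG, hG, hG'⟩ := exists_measurableSet_fiberConstOn hf hg hA (by
    rintro _ ⟨p, hp, rfl⟩ _ ⟨p', hp', rfl⟩ hpp
    by_contra hne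
    have hup : ∀ j ≤ n, Function.update p (n + 1) (p' i) j = p j := fun j hj =>
      Function.update_of_ne (by omega) _ _
    obtain ⟨j, hj, hjB⟩ := hcov (Function.update p (n + 1) (p' i)) (by
      refine ⟨fun j hj => ?_, ?_, ?_, ?_⟩
      · rw [hup j hj, hup 0 (Nat.zero_le _)]
        exact hp.1 j hj
      · simpa using (hp'.1 i hi).1
      · rw [hup 0 (Nat.zero_le _), Function.update_self, ← (hp.1 i hi).2]
        exact hpp.symm
      · rw [hup i hi, Function.update_self]
        exact hne)
    rcases Nat.lt_or_ge n j with hlt | hle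
    · obtain rfl : j = n + 1 := by omega
      rw [Function.update_self] at hjB
      exact hp'.2 i hi hjB
    · rw [hup j hle] at hjB
      exact hp.2 j hle hjB)
  refine ⟨insert G 𝒢, h𝒢.insert hG hG', fun p hp => ?_⟩
  rw [sUnion_insert]
  by_cases hpB : ∀ j ≤ n, p j ∉ ⋃₀ 𝒢
  · exact ⟨i, hi, Or.inl (hAG ⟨p, ⟨hp, hpB⟩, rfl⟩)⟩
  · push Not at hpB
    obtain ⟨j, hj, hjB⟩ := hpB
    exact ⟨j, hj, Or.inr hjB⟩

end Splitting

/-- If a fiber of `f` contains a sequence on whose range `g` is nowhere locally constant, then `g`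
takes uncountably many values on that fiber. -/
theorem not_countable_image_fiber [MetricSpace Z] [CompleteSpace Z]
    [TopologicalSpace X] [T2Space X] [TopologicalSpace Y] [T2Space Y] {f : Z → X} {g : Z → Y}
    (hf : Continuous f) (hg : Continuous g) {z : ℕ → Z}
    (hz : ∀ i, f (z i) = f (z 0))
    (hdense : ∀ i, ∀ ε > 0, ∃ j, dist (z j) (z i) < ε ∧ g (z i) ≠ g (z j)) :
    ¬ (g '' (f ⁻¹' {f (z 0)})).Countable := by
  intro hcount
  set K := closure (range z)
  have hK : ∀ a ∈ K, f a = f (z 0) := fun a ha =>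
    closure_minimal (t := f ⁻¹' {f (z 0)}) (by rintro _ ⟨i, rfl⟩; exact hz i)
      (isClosed_singleton.preimage hf) ha
  have hzK : ∀ i, z i ∈ K := fun i => subset_closure ⟨i, rfl⟩
  have : CompleteSpace K := isClosed_closure.completeSpace_coe
  have : Nonempty K := ⟨⟨z 0, hzK 0⟩⟩
  have := hcount.to_subtype
  obtain ⟨y, a, ha⟩ := nonempty_interior_of_iUnion_of_closed
    (f := fun y : g '' (f ⁻¹' {f (z 0)}) => {a : K | g a = y})
    (fun y => isClosed_eq (hg.comp continuous_subtype_val) continuous_const)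
    (eq_univ_of_forall fun a => mem_iUnion.2 ⟨⟨g a, a, hK a a.2, rfl⟩, rfl⟩)
  obtain ⟨ε, hε, hball⟩ := Metric.mem_nhds_iff.1 (mem_interior_iff_mem_nhds.1 ha)
  obtain ⟨_, ⟨i, rfl⟩, hi⟩ := Metric.mem_closure_iff.1 a.2 ε hε
  rw [dist_comm] at hi
  obtain ⟨j, hj, hne⟩ := hdense i (ε - dist (z i) a) (by linarith)
  have hi' : g (z i) = y := @hball ⟨z i, hzK i⟩ hi
  have hj' : g (z j) = y := @hball ⟨z j, hzK j⟩ (by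
    rw [Metric.mem_ball, Subtype.dist_eq]
    have := dist_triangle (z j) (z i) a
    linarith)
  exact hne (hi'.trans hj'.symm)

section Metric

variable [MetricSpace Z] [CompleteSpace Z] [SecondCountableTopology Z]
  [MeasurableSpace Z] [BorelSpace Z]
  [TopologicalSpace X] [T2Space X] [SecondCountableTopology X] [MeasurableSpace X] [BorelSpace X]
  [TopologicalSpace Y] [T2Space Y] [SecondCountableTopology Y] [MeasurableSpace Y] [BorelSpace Y]
  {f : Z → X} {g : Z → Y}

/-- A non-negligible family of tuples can be split at coordinate `i` and refined to small closed
sets whose two copies of coordinate `i` have disjoint images under `g`. -/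
theorem exists_refinement (hf : Continuous f) (hg : Continuous g) {n : ℕ}
    {c : ℕ → Set Z} (hc : ∀ j, IsClosed (c j))
    (h : ¬ NegligibleTuples f g n (fiberTuples f n c)) {i : ℕ} (hi : i ≤ n) (N : ℕ) :
    ∃ c' : ℕ → Set Z, (∀ j, IsClosed (c' j)) ∧
      ¬ NegligibleTuples f g (n + 1) (fiberTuples f (n + 1) c') ∧
      (∀ j ≤ n, c' j ⊆ c j) ∧ c' (n + 1) ⊆ c i ∧
      (∀ j ≤ n + 1, ∀ a ∈ c' j, ∀ b ∈ c' j, dist a b ≤ 2 / (N + 1)) ∧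
      ∀ a ∈ c' i, ∀ b ∈ c' (n + 1), g a ≠ g b := by
  have : Nonempty Z := by
    by_contra hZ
    rw [not_nonempty_iff] at hZ
    exact h ⟨∅, ⟨countable_empty, by simp⟩, fun p => isEmptyElim (p 0)⟩
  let q := TopologicalSpace.denseSeq Z
  let cell : (Fin (n + 2) → ℕ) × ℕ → ℕ → Set Z := fun v j =>
    (if j ≤ n then c j else c i) ∩
      if hj : j < n + 2 then Metric.closedBall (q (v.1 ⟨j, hj⟩)) (1 / (v.2 + 1)) else univ
  by_contra! hno
  refine not_negligibleTuples_split hf hg (fun j => (hc j).measurableSet) h hi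
    (NegligibleTuples.of_subset_iUnion
      (S := fun v : {v : (Fin (n + 2) → ℕ) × ℕ // N ≤ v.2 ∧
        ∀ a ∈ cell v i, ∀ b ∈ cell v (n + 1), g a ≠ g b} => fiberTuples f (n + 1) (cell v)) ?_ ?_)
  · rintro ⟨v, hvN, hv⟩
    by_contra hL
    obtain ⟨a, ha, b, hb, hab⟩ := hno (cell v) (fun j => by
      refine IsClosed.inter ?_ ?_ <;> split_ifs
      exacts [hc j, hc i, Metric.isClosed_closedBall, isClosed_univ]) hL
      (fun j hj => by simp [cell, hj]) (by simp [cell]) (fun j hj a ha b hb => by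
        have ha' := ha.2
        have hb' := hb.2
        rw [dif_pos (by omega), Metric.mem_closedBall] at ha' hb'
        have h1 : (1 : ℝ) / (v.2 + 1) ≤ 1 / (N + 1) := by
          gcongr
        calc dist a b ≤ _ := dist_triangle_right _ _ _
          _ ≤ 1 / (N + 1) + 1 / (N + 1) := add_le_add (ha'.trans h1) (hb'.trans h1)
          _ = 2 / (N + 1) := by ring)
    exact hv a ha b hb hab
  · rintro p ⟨hp, hpc, hpf, hpg⟩
    obtain ⟨U, V, hU, hV, hpU, hpV, hUV⟩ := t2_separation hpg
    obtain ⟨ε, hε, hεU⟩ := Metric.isOpen_iff.1 (hU.preimage hg) (p i) hpU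
    obtain ⟨δ, hδ, hδV⟩ := Metric.isOpen_iff.1 (hV.preimage hg) (p (n + 1)) hpV
    obtain ⟨m, hm⟩ := exists_nat_one_div_lt (half_pos (lt_min hε hδ))
    set M := max m N
    have hM : (1 : ℝ) / (M + 1) < min ε δ / 2 := by
      refine lt_of_le_of_lt ?_ hm
      gcongr
      exact le_max_left _ _
    have hMpos : (0 : ℝ) < 1 / (M + 1) := Nat.one_div_pos_of_nat
    have hq : ∀ j, ∃ k, dist (p j) (q k) < 1 / (M + 1) := fun j => by
      obtain ⟨k, hk⟩ :=
        (TopologicalSpace.denseRange_denseSeq Z).exists_dist_lt (p j) hMpos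
      exact ⟨k, hk⟩
    choose k hk using hq
    let v : (Fin (n + 2) → ℕ) × ℕ := (fun j => k j, M)
    have close : ∀ j ≤ n + 1, ∀ a ∈ cell v j, dist a (p j) < min ε δ := fun j hj a ha => by
      have ha' := ha.2
      rw [dif_pos (by omega), Metric.mem_closedBall] at ha'
      calc dist a (p j) ≤ _ := dist_triangle_right _ _ (q (k j))
        _ < min ε δ := by have := hk j; linarith
    refine mem_iUnion.2 ⟨⟨v, le_max_right _ _, fun a ha b hb hab => ?_⟩, fun j hj => ⟨⟨?_, ?_⟩, ?_⟩⟩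
    · have hga : g a ∈ U := hεU ((close i (by omega) a ha).trans_le (min_le_left _ _))
      have hgb : g b ∈ V := hδV ((close (n + 1) le_rfl b hb).trans_le (min_le_right _ _))
      exact Set.disjoint_left.1 hUV hga (hab ▸ hgb)
    · split_ifs with hjn
      · exact (hp j hjn).1
      · obtain rfl : j = n + 1 := by omega
        exact hpc
    · rw [dif_pos (by omega)]
      exact (hk j).le
    · rcases Nat.lt_or_ge n j with hlt | hle
      · obtain rfl : j = n + 1 := by omega
        exact hpf
      · exact (hp j hle).2

theorem exists_isUniformFamily_of_metric (hf : Continuous f) (hg : Continuous g)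
    (hcount : ∀ x, (g '' (f ⁻¹' {x})).Countable) :
    ∃ 𝒢, IsUniformFamily f g 𝒢 ∧ ⋃₀ 𝒢 = univ := by
  by_contra hno
  let Good : ℕ → (ℕ → Set Z) → Prop := fun n c =>
    (∀ j, IsClosed (c j)) ∧ ¬ NegligibleTuples f g n (fiberTuples f n c)
  have h0 : Good 0 fun _ => univ := by
    refine ⟨fun _ => isClosed_univ, fun ⟨𝒢, h𝒢, hcov⟩ => hno ⟨𝒢, h𝒢, ?_⟩⟩
    refine eq_univ_of_forall fun a => ?_
    obtain ⟨j, -, hj⟩ := hcov (fun _ => a) (by simp [fiberTuples])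
    exact hj
  have hstep : ∀ n c, Good n c → ∃ c', Good (n + 1) c' ∧
      (∀ j ≤ n, c' j ⊆ c j) ∧ c' (n + 1) ⊆ c n.unpair.1 ∧
      (∀ j ≤ n + 1, ∀ a ∈ c' j, ∀ b ∈ c' j, dist a b ≤ 2 / (n + 1)) ∧
      ∀ a ∈ c' n.unpair.1, ∀ b ∈ c' (n + 1), g a ≠ g b := fun n c hc => by
    obtain ⟨c', h1, h2, h3⟩ := exists_refinement hf hg hc.1 hc.2 (Nat.unpair_left_le n) n
    exact ⟨c', ⟨h1, h2⟩, h3⟩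
  choose! next hnext using hstep
  let c : ℕ → ℕ → Set Z := fun n => Nat.rec (fun _ => univ) next n
  have hgood : ∀ n, Good n (c n) := fun n => by
    induction n with
    | zero => exact h0
    | succ n ih => exact (hnext n _ ih).1
  have hc := fun n => (hnext n (c n) (hgood n)).2
  change ∀ n, (∀ j ≤ n, c (n + 1) j ⊆ c n j) ∧ c (n + 1) (n + 1) ⊆ c n n.unpair.1 ∧
      (∀ j ≤ n + 1, ∀ a ∈ c (n + 1) j, ∀ b ∈ c (n + 1) j, dist a b ≤ 2 / (n + 1)) ∧
      ∀ a ∈ c (n + 1) n.unpair.1, ∀ b ∈ c (n + 1) (n + 1), g a ≠ g b at hc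
  have hmono : ∀ j m n, j ≤ m → m ≤ n → c n j ⊆ c m j := fun j m n hjm hmn => by
    induction n, hmn using Nat.le_induction with
    | base => exact subset_rfl
    | succ n hmn ih => exact ((hc n).1 j (hjm.trans hmn)).trans ih
  have hne : ∀ n, ∃ p, p ∈ fiberTuples f n (c n) := fun n => by
    by_contra! hemp
    exact (hgood n).2 ⟨∅, ⟨countable_empty, by simp⟩, fun p hp => (hemp p hp).elim⟩
  choose p hp using hne
  have hpc : ∀ j m n, j ≤ m → m ≤ n → p n j ∈ c m j := fun j m n hjm hmn =>
    hmono j m n hjm hmn (hp n j (hjm.trans hmn)).1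
  have hsmall : ∀ ε > (0 : ℝ), ∃ M : ℕ, ∀ n ≥ M, (2 : ℝ) / (n + 1) < ε := fun ε hε => by
    obtain ⟨M, hM⟩ := exists_nat_one_div_lt (half_pos hε)
    refine ⟨M, fun n hn => ?_⟩
    have : (1 : ℝ) / (n + 1) ≤ 1 / (M + 1) := by gcongr
    calc (2 : ℝ) / (n + 1) = 2 * (1 / (n + 1)) := by ring
      _ < ε := by linarith
  have hlim : ∀ j, ∃ z, Tendsto (fun n => p n j) atTop (𝓝 z) := fun j => by
    refine cauchySeq_tendsto_of_complete (Metric.cauchySeq_iff'.2 fun ε hε => ?_)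
    obtain ⟨M, hM⟩ := hsmall ε hε
    refine ⟨max M j + 1, fun n hn => ?_⟩
    exact ((hc (max M j)).2.2.1 j (by omega) _ (hpc j (max M j + 1) n (by omega) hn) _
      (hpc j (max M j + 1) _ (by omega) le_rfl)).trans_lt (hM _ (le_max_left _ _))
  choose z hz using hlim
  have hzc : ∀ j m, j ≤ m → z j ∈ c m j := fun j m hjm =>
    ((hgood m).1 j).mem_of_tendsto (hz j)
      (eventually_atTop.2 ⟨m, fun n hn => hpc j m n hjm hn⟩)
  refine not_countable_image_fiber (z := z) hf hg (fun j => ?_) (fun i ε hε => ?_) (hcount _)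
  · refine tendsto_nhds_unique ((hf.tendsto _).comp (hz j)) ?_
    refine ((hf.tendsto _).comp (hz 0)).congr' (eventually_atTop.2 ⟨j, fun n hn => ?_⟩)
    exact ((hp n j hn).2).symm
  · obtain ⟨M, hM⟩ := hsmall ε hε
    set n := Nat.pair i (M + i + 1)
    have hnM : M + i + 1 ≤ n := Nat.right_le_pair _ _
    have hni : n.unpair.1 = i := by simp [n]
    obtain ⟨n', hn'⟩ : ∃ n', n = n' + 1 := ⟨n - 1, by omega⟩
    have hsplit := hc n
    rw [hni] at hsplit
    refine ⟨n + 1, ?_, hsplit.2.2.2 _ (hzc i (n + 1) (by omega)) _ (hzc (n + 1) (n + 1) le_rfl)⟩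
    have h1 : z (n + 1) ∈ c n i := hsplit.2.1 (hzc (n + 1) (n + 1) le_rfl)
    have h2 : z i ∈ c n i := hzc i n (by omega)
    exact ((hc n').2.2.1 i (by omega) _ (by rwa [← hn']) _ (by rwa [← hn'])).trans_lt
      (hM n' (by omega))

end Metric

/-- **Lusin–Novikov**: a Borel set with countable sections is a countable union of Borel graphs
of partial functions. -/
theorem exists_isUniformFamily_of_countable_sections
    [TopologicalSpace X] [PolishSpace X] [MeasurableSpace X] [BorelSpace X]
    [TopologicalSpace Y] [PolishSpace Y] [MeasurableSpace Y] [BorelSpace Y]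
    {P : Set (X × Y)} (hP : MeasurableSet P) (hcount : ∀ x, {y | (x, y) ∈ P}.Countable) :
    ∃ 𝒢, IsUniformFamily Prod.fst Prod.snd 𝒢 ∧ ⋃₀ 𝒢 = P := by
  have hPa := hP.analyticSet
  rw [AnalyticSet] at hPa
  rcases hPa with rfl | ⟨φ, hφ, rfl⟩
  · exact ⟨∅, ⟨countable_empty, by simp⟩, by simp⟩
  let := TopologicalSpace.upgradeIsCompletelyMetrizable (ℕ → ℕ)
  obtain ⟨𝒢, h𝒢, hcov⟩ := exists_isUniformFamily_of_metric (Z := ℕ → ℕ)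
    (continuous_fst.comp hφ) (continuous_snd.comp hφ) (fun x => (hcount x).mono (by
      rintro _ ⟨a, rfl, rfl⟩
      exact ⟨a, rfl⟩))
  have hext : ∀ G : 𝒢, ∃ H, φ '' G ⊆ H ∧ MeasurableSet H ∧
      FiberConstOn (Prod.fst : X × Y → X) Prod.snd H := fun G => by
    refine exists_measurableSet_fiberConstOn continuous_fst continuous_snd
      ((h𝒢.2 G G.2).1.analyticSet.image_of_continuous hφ) ?_
    rintro _ ⟨a, ha, rfl⟩ _ ⟨b, hb, rfl⟩ hab
    exact (h𝒢.2 G G.2).2 a ha b hb hab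
  choose H hGH hHm hH using hext
  have := h𝒢.1.to_subtype
  refine ⟨range fun G => H G ∩ range φ, ⟨countable_range _, ?_⟩, ?_⟩
  · rintro _ ⟨G, rfl⟩
    exact ⟨(hHm G).inter hP, fun a ha b hb => hH G a ha.1 b hb.1⟩
  · refine Subset.antisymm (sUnion_subset ?_) ?_
    · rintro _ ⟨G, rfl⟩
      exact inter_subset_right
    · rintro _ ⟨a, rfl⟩
      obtain ⟨G, hG, haG⟩ := hcov.symm ▸ mem_univ a
      exact ⟨_, ⟨⟨G, hG⟩, rfl⟩, hGH ⟨G, hG⟩ ⟨a, haG, rfl⟩, a, rfl⟩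

/-- The total extension, by the identity, of a partial function with Borel graph is Borel. -/
theorem exists_measurable_of_fiberConstOn
    [TopologicalSpace X] [PolishSpace X] [MeasurableSpace X] [BorelSpace X]
    {G : Set (X × X)} (hG : MeasurableSet G) (hG' : FiberConstOn Prod.fst Prod.snd G) :
    ∃ φ : X → X, Measurable φ ∧ (∀ x y, (x, y) ∈ G → φ x = y) ∧
      ∀ x, (x, φ x) ∈ G ∨ φ x = x := by
  classical
  have him : ∀ {S : Set (X × X)}, MeasurableSet S → S ⊆ G → MeasurableSet (Prod.fst '' S) :=
    fun hS hSG => hS.image_of_measurable_injOn measurable_fst fun a ha b hb hab =>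
      Prod.ext hab (hG' a (hSG ha) b (hSG hb) hab)
  let φ : X → X := fun x => if h : ∃ y, (x, y) ∈ G then h.choose else x
  have hφG : ∀ x y, (x, y) ∈ G → φ x = y := fun x y hxy => by
    have h : ∃ y, (x, y) ∈ G := ⟨y, hxy⟩
    simp only [φ, dif_pos h]
    exact hG' _ h.choose_spec _ hxy rfl
  have hφ : ∀ x, (¬ ∃ y, (x, y) ∈ G) → φ x = x := fun x h => by simp only [φ, dif_neg h]
  refine ⟨φ, fun S hS => ?_, hφG, fun x => ?_⟩
  · have : φ ⁻¹' S = Prod.fst '' (G ∩ Prod.snd ⁻¹' S) ∪ ((Prod.fst '' G)ᶜ ∩ S) := by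
      ext x
      by_cases h : ∃ y, (x, y) ∈ G
      · obtain ⟨y, hy⟩ := h
        have hx : x ∈ Prod.fst '' G := ⟨(x, y), hy, rfl⟩
        simp only [mem_preimage, hφG x y hy, mem_union, mem_inter_iff, mem_compl_iff, hx,
          not_true_eq_false, false_and, or_false]
        constructor
        · exact fun hyS => ⟨(x, y), ⟨hy, hyS⟩, rfl⟩
        · rintro ⟨⟨x', y'⟩, ⟨hG1, hS1⟩, rfl⟩
          rwa [show y = y' from hG' _ hy _ hG1 rfl]
      · have hx : x ∉ Prod.fst '' G := by
          rintro ⟨⟨x', y⟩, hy, rfl⟩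
          exact h ⟨y, hy⟩
        have hx' : x ∉ Prod.fst '' (G ∩ Prod.snd ⁻¹' S) :=
          fun hm => hx (image_mono inter_subset_left hm)
        simp [hφ x h, hx, hx']
    rw [this]
    exact (him (hG.inter (measurable_snd hS)) inter_subset_left).union
      ((him hG subset_rfl).compl.inter hS)
  · by_cases h : ∃ y, (x, y) ∈ G
    · obtain ⟨y, hy⟩ := h
      exact Or.inl (hφG x y hy ▸ hy)
    · exact Or.inr (hφ x h)

/-- The classes of a countable Borel equivalence relation are enumerated by countably many
Borel functions. -/
theorem exists_measurable_enumeration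
    [TopologicalSpace X] [PolishSpace X] [MeasurableSpace X] [BorelSpace X]
    {F : X → X → Prop} (hrefl : ∀ x, F x x) (hF : MeasurableSet {p : X × X | F p.1 p.2})
    (hcount : ∀ x, {y | F x y}.Countable) :
    ∃ φ : ℕ → X → X, (∀ n, Measurable (φ n)) ∧ ∀ x y, F x y ↔ ∃ n, φ n x = y := by
  obtain ⟨𝒢, h𝒢, hcov⟩ := exists_isUniformFamily_of_countable_sections hF hcount
  have : Countable (insert ∅ 𝒢 : Set (Set (X × X))) := (h𝒢.1.insert ∅).to_subtype
  have : Nonempty (insert ∅ 𝒢 : Set (Set (X × X))) := ⟨⟨∅, mem_insert _ _⟩⟩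
  obtain ⟨e, he⟩ := exists_surjective_nat (insert ∅ 𝒢 : Set (Set (X × X)))
  have hins := h𝒢.insert MeasurableSet.empty (fun z hz => hz.elim)
  choose φ hφ hφG hφF using fun n =>
    exists_measurable_of_fiberConstOn (hins.2 _ (e n).2).1 (hins.2 _ (e n).2).2
  refine ⟨φ, hφ, fun x y => ⟨fun h => ?_, ?_⟩⟩
  · obtain ⟨G, hG, hxy⟩ : (x, y) ∈ ⋃₀ 𝒢 := hcov ▸ h
    obtain ⟨n, hn⟩ := he ⟨G, mem_insert_of_mem _ hG⟩
    exact ⟨n, hφG n x y (by rw [hn]; exact hxy)⟩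
  · rintro ⟨n, rfl⟩
    rcases hφF n x with h | h
    · have hsub : ((e n : Set (X × X))) ⊆ ⋃₀ 𝒢 := by
        rcases (e n).2 with h0 | h0
        · rw [h0]; exact empty_subset _
        · exact subset_sUnion_of_mem h0
      have := hsub h
      rwa [hcov] at this
    · rw [h]; exact hrefl x

end LusinNovikov

section FiniteSubsets

open Set

variable {X : Type} [MetricSpace X]

/-- The finite set `{φ 0 x, …, φ N x}`. -/
def initialValues (φ : ℕ → X → X) : ℕ → X → NonemptyCompacts X
  | 0, x => {φ 0 x}
  | N + 1, x => initialValues φ N x ⊔ {φ (N + 1) x}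

theorem mem_initialValues {φ : ℕ → X → X} {N : ℕ} {x y : X} :
    y ∈ (initialValues φ N x : Set X) ↔ ∃ n ≤ N, φ n x = y := by
  induction N with
  | zero => simp [initialValues, eq_comm]
  | succ N ih =>
    simp only [initialValues, NonemptyCompacts.coe_sup, mem_union, ih,
      NonemptyCompacts.coe_singleton, mem_singleton_iff, Nat.le_succ_iff]
    constructor
    · rintro (⟨n, hn, rfl⟩ | rfl)
      exacts [⟨n, Or.inl hn, rfl⟩, ⟨N + 1, Or.inr rfl, rfl⟩]
    · rintro ⟨n, hn | rfl, rfl⟩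
      exacts [Or.inl ⟨n, hn, rfl⟩, Or.inr rfl]

theorem finite_initialValues (φ : ℕ → X → X) (N : ℕ) (x : X) :
    (initialValues φ N x : Set X).Finite :=
  ((finite_Iic N).image fun n => φ n x).subset fun _ hy => mem_initialValues.1 hy

theorem measurable_initialValues [SecondCountableTopology X] [MeasurableSpace X] [BorelSpace X]
    {φ : ℕ → X → X} (hφ : ∀ n, Measurable (φ n)) (N : ℕ) : Measurable (initialValues φ N) := by
  induction N with
  | zero => exact NonemptyCompacts.continuous_singleton.measurable.comp (hφ 0)
  | succ N ih =>
    exact ih.sup (NonemptyCompacts.continuous_singleton.measurable.comp (hφ (N + 1)))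

/-- A finite index extension of `E` with Borel-enumerated classes admits a Borel choice of a
finite set meeting exactly the `E`-classes inside the given `F`-class. -/
theorem exists_measurable_finite_transversal [SecondCountableTopology X]
    [MeasurableSpace X] [BorelSpace X] {E F : X → X → Prop} (hE : Equivalence E)
    (hEBorel : MeasurableSet {p : X × X | E p.1 p.2})
    (hfinindex : ∀ x : X, ∃ s : Finset X, ∀ y, F x y → ∃ z ∈ s, E z y)
    {φ : ℕ → X → X} (hφ : ∀ n, Measurable (φ n)) (hφF : ∀ x y, F x y ↔ ∃ n, φ n x = y) :
    ∃ u : X → FinSubsets X, Measurable u ∧ (∀ x, ∀ y ∈ ((u x).1 : Set X), F x y) ∧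
      ∀ x y, F x y → ∃ z ∈ ((u x).1 : Set X), E z y := by
  classical
  have hex : ∀ x, ∃ N, ∀ m, ∃ n ≤ N, E (φ n x) (φ m x) := fun x => by
    obtain ⟨s, hs⟩ := hfinindex x
    have hrep : ∀ a, ∃ k, (∃ m, E a (φ m x)) → E a (φ k x) := fun a => by
      by_cases h : ∃ m, E a (φ m x)
      · exact ⟨h.choose, fun _ => h.choose_spec⟩
      · exact ⟨0, fun h' => (h h').elim⟩
    choose k hk using hrep
    refine ⟨s.sup k, fun m => ?_⟩
    obtain ⟨a, ha, ham⟩ := hs (φ m x) ((hφF _ _).2 ⟨m, rfl⟩)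
    exact ⟨k a, Finset.le_sup ha, hE.trans (hE.symm (hk a ⟨m, ham⟩)) ham⟩
  refine ⟨fun x => ⟨initialValues φ (Nat.find (hex x)) x, finite_initialValues _ _ _⟩,
    Measurable.subtype_mk (Measurable.find (f := initialValues φ)
      (measurable_initialValues hφ) (fun N => ?_) hex), fun x y hy => ?_, fun x y hxy => ?_⟩
  · refine measurableSet_setOfPred.2 (Measurable.forall fun m => Measurable.exists fun n =>
      measurable_const.and ?_)
    exact measurableSet_setOfPred.1 (((hφ n).prodMk (hφ m)) hEBorel)
  · obtain ⟨n, -, rfl⟩ := mem_initialValues.1 hy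
    exact (hφF _ _).2 ⟨n, rfl⟩
  · obtain ⟨m, rfl⟩ := (hφF _ _).1 hxy
    obtain ⟨n, hn, hE⟩ := Nat.find_spec (hex x) m
    exact ⟨φ n x, mem_initialValues.2 ⟨n, hn, rfl⟩, hE⟩

end FiniteSubsets

/-- if `E ⊆ F` are countable Borel equivalence relations on a Polish space,
`F` is a finite index extension of `E`, and `F` is not Borel reducible to `E`, then
`E <_B E^fin`: `E` is Borel reducible to `E^fin` but `E^fin` is not Borel reducible to `E`. -/
theorem stmt15 {X : Type} [MetricSpace X] [SecondCountableTopology X] [CompleteSpace X]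
    [MeasurableSpace X] [BorelSpace X]
    (E F : X → X → Prop) (hEeq : Equivalence E) (hFeq : Equivalence F)
    (hEBorel : MeasurableSet {p : X × X | E p.1 p.2})
    (hFBorel : MeasurableSet {p : X × X | F p.1 p.2})
    (hEcount : ∀ x : X, {y : X | E x y}.Countable)
    (hFcount : ∀ x : X, {y : X | F x y}.Countable)
    (hsub : ∀ x y, E x y → F x y)
    (hfinindex : ∀ x : X, ∃ s : Finset X, ∀ y, F x y → ∃ z ∈ s, E z y)
    (hnotred : ¬ ∃ g : X → X, Measurable g ∧ ∀ x y, F x y ↔ E (g x) (g y)) :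
    (∃ f : X → FinSubsets X, Measurable f ∧ ∀ x y, E x y ↔ EFin E (f x) (f y)) ∧
    ¬ ∃ h : FinSubsets X → X, Measurable h ∧ ∀ u v, EFin E u v ↔ E (h u) (h v) := by
  refine ⟨⟨fun x => ⟨{x}, by simp⟩, ?_, fun x y => ?_⟩, ?_⟩
  · exact NonemptyCompacts.continuous_singleton.measurable.subtype_mk
  · simp [EFin]
  rintro ⟨h, hh, hred⟩
  obtain ⟨φ, hφ, hφF⟩ := exists_measurable_enumeration hFeq.refl hFBorel hFcount
  obtain ⟨u, hu, huF, huE⟩ :=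
    exists_measurable_finite_transversal hEeq hEBorel hfinindex hφ hφF
  have key : ∀ x y, F x y → ∀ a ∈ ((u x).1 : Set X), ∃ b ∈ ((u y).1 : Set X), E b a :=
    fun x y hxy a ha => huE y a (hFeq.trans (hFeq.symm hxy) (huF x a ha))
  refine hnotred ⟨fun x => h (u x), hh.comp hu, fun x y => ?_⟩
  rw [← hred]
  refine ⟨fun hxy => ⟨fun a ha => ?_, key y x (hFeq.symm hxy)⟩, fun hxy => ?_⟩
  · obtain ⟨b, hb, hba⟩ := key x y hxy a ha
    exact ⟨b, hb, hEeq.symm hba⟩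
  · obtain ⟨a, ha, -⟩ := huE x x (hFeq.refl x)
    obtain ⟨b, hb, hab⟩ := hxy.1 a ha
    exact hFeq.trans (huF x a ha) (hFeq.trans (hsub _ _ hab) (hFeq.symm (huF y b hb)))
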